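/- Regularity of conformal mappings, Hölder case (Theorem 3.2, interior coordinate version): Let n ≥ 3, k ∈ ℕ with k ≥ 2, and α ∈ (0,1). Let g and h be metrics of class C^{k+α} on open sets U and V in ℝⁿ respectively, and let F : U → V be a C³ map with DF(x) invertible for every x ∈ U and DF(x)ᵀ h(F(x)) DF(x) = c(x) g(x) for all x ∈ U, where c : U → ℝ is a function. Then F is of class C^{k+1+α} on U; moreover, every C¹ local inverse of F is of class C^{k+1+α}. -/

import Mathlib

noncomputable section

open Set Matrix Matrix

/-- Points of `ℝⁿ`. -/
abbrev Pt (n : ℕ) := Fin n → ℝ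

/-- A metric in coordinates: a matrix-valued map. -/
abbrev Met (n : ℕ) := Pt n → Matrix (Fin n) (Fin n) ℝ

/-- Partial derivative of `f` in the `a`-th coordinate direction. -/
def pd {n : ℕ} (a : Fin n) (f : Pt n → ℝ) (x : Pt n) : ℝ :=
  fderiv ℝ f x (Pi.single a 1)

/-- `g` is a metric (pointwise symmetric positive definite) on `U`. -/
def IsMetricOn {n : ℕ} (g : Met n) (U : Set (Pt n)) : Prop :=
  ∀ x ∈ U, (g x).IsSymm ∧ (g x).PosDef

/-- Christoffel symbols `Γ^c_{ab}` of `g`. -/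
def christoffel {n : ℕ} (g : Met n) (c a b : Fin n) (x : Pt n) : ℝ :=
  (1 / 2) * ∑ d, (g x)⁻¹ c d *
    (pd a (fun y => g y b d) x + pd b (fun y => g y a d) x - pd d (fun y => g y a b) x)

/-- Ricci tensor `R_{ab}` of `g`. -/
def ricci {n : ℕ} (g : Met n) (a b : Fin n) (x : Pt n) : ℝ :=
  (∑ c, pd c (christoffel g c a b) x) - (∑ c, pd a (christoffel g c c b) x)
    + (∑ c, ∑ d, christoffel g c a b x * christoffel g d d c x)
    - (∑ c, ∑ d, christoffel g d c b x * christoffel g c a d x)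

/-- Scalar curvature `R(g)`. -/
def scalarCurv {n : ℕ} (g : Met n) (x : Pt n) : ℝ :=
  ∑ a, ∑ b, (g x)⁻¹ a b * ricci g a b x

/-- Laplace–Beltrami operator `Δ_g`. -/
def laplaceBeltrami {n : ℕ} (g : Met n) (u : Pt n → ℝ) (x : Pt n) : ℝ :=
  -(Real.sqrt (g x).det)⁻¹ *
    ∑ a, pd a (fun y => Real.sqrt (g y).det * ∑ b, (g y)⁻¹ a b * pd b u y) x

/-- Conformal Laplacian `L_g`. -/
def confLap {n : ℕ} (g : Met n) (u : Pt n → ℝ) (x : Pt n) : ℝ :=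
  laplaceBeltrami g u x + (((n : ℝ) - 2) / (4 * ((n : ℝ) - 1))) * scalarCurv g x * u x

/-- `f` is of class `C^{k+α}` on `s`: it is `C^k` there and its `k`-th order derivatives are
locally `α`-Hölder continuous. -/
def CHolderOn {n : ℕ} (k : ℕ) (α : ℝ) (s : Set (Pt n)) (f : Pt n → ℝ) : Prop :=
  ContDiffOn ℝ k f s ∧
    ∀ x ∈ s, ∃ C : NNReal, ∃ t ∈ nhdsWithin x s,
      HolderOnWith C (Real.toNNReal α) (iteratedFDerivWithin ℝ k f s) t

/-- All entries of `g` are of class `C^{k+α}` on `s`. -/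
def MetCHolderOn {n : ℕ} (k : ℕ) (α : ℝ) (s : Set (Pt n)) (g : Met n) : Prop :=
  ∀ a b, CHolderOn k α s fun x => g x a b

/-- Contracted Christoffel symbol `Γ^a = g^{bc} Γ^a_{bc}`. -/
def gammaUp {n : ℕ} (g : Met n) (a : Fin n) (x : Pt n) : ℝ :=
  ∑ b, ∑ c, (g x)⁻¹ b c * christoffel g a b c x

/-- Contracted Christoffel symbol `Γ_a = g_{ab} Γ^b`. -/
def gammaLow {n : ℕ} (g : Met n) (a : Fin n) (x : Pt n) : ℝ :=
  ∑ b, g x a b * gammaUp g b x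

/-- `g` satisfies the conformal harmonic gauge on `U`. -/
def ConfHarmonicGauge {n : ℕ} (g : Met n) (U : Set (Pt n)) : Prop :=
  ∃ f : Pt n → ℝ, ContDiffOn ℝ 2 f U ∧ (∀ x ∈ U, 0 < f x) ∧
    (∀ x ∈ U, confLap g f x = 0) ∧
    ∀ a : Fin n, ∀ x ∈ U, gammaLow g a x = 2 * pd a (fun y => Real.log (f y)) x

/-- Determinant-normalized metric `ĝ = (det g)^{-1/n} g`. -/
def dnorm {n : ℕ} (g : Met n) : Met n :=
  fun x => ((g x).det ^ (-(1 : ℝ) / (n : ℝ))) • g x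

/-- Jacobian matrix of a map `Z : ℝⁿ → ℝⁿ`. -/
def jac {n : ℕ} (Z : Pt n → Pt n) (x : Pt n) : Matrix (Fin n) (Fin n) ℝ :=
  Matrix.of fun i j => pd j (fun y => Z y i) x

/-- Riemann curvature tensor `R_{abc}{}^{d}`. -/
def riemannUp {n : ℕ} (g : Met n) (a b c d : Fin n) (x : Pt n) : ℝ :=
  pd a (christoffel g d b c) x - pd b (christoffel g d a c) x
    + (∑ e, christoffel g e b c x * christoffel g d a e x)
    - (∑ e, christoffel g e a c x * christoffel g d b e x)

/-- Riemann curvature tensor `R_{abcd} = R_{abc}{}^{e} g_{ed}`. -/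
def riemannLow {n : ℕ} (g : Met n) (a b c d : Fin n) (x : Pt n) : ℝ :=
  ∑ e, riemannUp g a b c e x * g x e d

/-- Schouten tensor `P_{ab}`. -/
def schouten {n : ℕ} (g : Met n) (a b : Fin n) (x : Pt n) : ℝ :=
  (1 / ((n : ℝ) - 2)) * (ricci g a b x - (scalarCurv g x / (2 * ((n : ℝ) - 1))) * g x a b)

/-- Weyl tensor `W_{abcd}`. -/
def weyl {n : ℕ} (g : Met n) (a b c d : Fin n) (x : Pt n) : ℝ :=
  riemannLow g a b c d x + schouten g a c x * g x b d - schouten g b c x * g x a d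
    + schouten g b d x * g x a c - schouten g a d x * g x b c

/-- Weyl tensor with raised last index, `W_{abc}{}^{d} = g^{de} W_{abce}`. -/
def weylUp {n : ℕ} (g : Met n) (a b c d : Fin n) (x : Pt n) : ℝ :=
  ∑ e, (g x)⁻¹ d e * weyl g a b c e x

/-- Covariant derivative of a 2-tensor: `(∇T)_{cab} = ∇_c T_{ab}`. -/
def cov2 {n : ℕ} (g : Met n) (T : Fin n → Fin n → Pt n → ℝ) (c a b : Fin n) (x : Pt n) : ℝ :=
  pd c (T a b) x - (∑ d, christoffel g d c a x * T d b x)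
    - ∑ d, christoffel g d c b x * T a d x

/-- Covariant derivative of a 3-tensor: `(∇T)_{dabc} = ∇_d T_{abc}`. -/
def cov3 {n : ℕ} (g : Met n) (T : Fin n → Fin n → Fin n → Pt n → ℝ) (d a b c : Fin n)
    (x : Pt n) : ℝ :=
  pd d (T a b c) x - (∑ e, christoffel g e d a x * T e b c x)
    - (∑ e, christoffel g e d b x * T a e c x)
    - ∑ e, christoffel g e d c x * T a b e x

/-- Cotton tensor `C_{abc} = ∇_a P_{bc} - ∇_b P_{ac}`. -/
def cotton {n : ℕ} (g : Met n) (a b c : Fin n) (x : Pt n) : ℝ :=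
  cov2 g (schouten g) a b c x - cov2 g (schouten g) b a c x

/-- Bach tensor `B_{ab}`. -/
def bach {n : ℕ} (g : Met n) (a b : Fin n) (x : Pt n) : ℝ :=
  (∑ c, ∑ d, (g x)⁻¹ c d *
      (cov3 g (cov2 g (schouten g)) d a b c x - cov3 g (cov2 g (schouten g)) d c a b x))
    + ∑ c, ∑ d, ∑ e, ∑ f, (g x)⁻¹ c e * (g x)⁻¹ d f * schouten g e f x * weyl g a c d b x
section LocallyHolder

variable {n : ℕ} {α : ℝ} {s : Set (Pt n)}
variable {E E' : Type*} [NormedAddCommGroup E] [NormedAddCommGroup E']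

/-- `f` is locally `α`-Hölder continuous on `s`. -/
def LocHolderOn (α : ℝ) (s : Set (Pt n)) (f : Pt n → E) : Prop :=
  ∀ x ∈ s, ∃ C : NNReal, ∃ t ∈ nhdsWithin x s, HolderOnWith C (Real.toNNReal α) f t

lemma LocHolderOn.congr {f f' : Pt n → E} (hf : LocHolderOn α s f) (h : EqOn f' f s) :
    LocHolderOn α s f' := by
  intro x hx
  obtain ⟨C, t, ht, hC⟩ := hf x hx
  refine ⟨C, t ∩ s, Filter.inter_mem ht self_mem_nhdsWithin, fun y hy z hz => ?_⟩
  rw [h hy.2, h hz.2]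
  exact hC y hy.1 z hz.1

lemma LocHolderOn.prodMk {f : Pt n → E} {f' : Pt n → E'} (hf : LocHolderOn α s f)
    (hf' : LocHolderOn α s f') : LocHolderOn α s (fun x => (f x, f' x)) := by
  intro x hx
  obtain ⟨C, t, ht, hC⟩ := hf x hx
  obtain ⟨C', t', ht', hC'⟩ := hf' x hx
  refine ⟨max C C', t ∩ t', Filter.inter_mem ht ht', fun y hy z hz => ?_⟩
  rw [Prod.edist_eq, max_le_iff]
  exact ⟨(hC.mono_const (le_max_left C C')) y hy.1 z hz.1,
    (hC'.mono_const (le_max_right C C')) y hy.2 z hz.2⟩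

lemma locHolderOn_const (v : E) : LocHolderOn α s (fun _ => v) := fun x _ =>
  ⟨0, s, self_mem_nhdsWithin, fun y _ z _ => by simp⟩

lemma LipschitzOnWith.exists_holderOnWith {f : Pt n → E} {K : NNReal} {t : Set (Pt n)}
    (hα : α < 1) (hf : LipschitzOnWith K f t) (ht : ∀ x ∈ t, ∀ y ∈ t, edist x y ≤ 1) :
    ∃ C, HolderOnWith C (Real.toNNReal α) f t :=
  ⟨_, (holderOnWith_one.mpr hf).of_le (D := 1) (by simpa using ht)
    (by rw [Real.toNNReal_le_one]; exact hα.le)⟩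

lemma LocHolderOn.comp_contDiffOn {f : Pt n → E} {t : Set (Pt n)} {G : Pt n → Pt n}
    (hf : LocHolderOn α t f) (hs : IsOpen s) (ht : IsOpen t) (hG : ContDiffOn ℝ 1 G s)
    (hGt : MapsTo G s t) : LocHolderOn α s (fun x => f (G x)) := by
  intro x hx
  obtain ⟨C, u, hu, hC⟩ := hf _ (hGt hx)
  rw [ht.nhdsWithin_eq (hGt hx)] at hu
  have hGx := hG.contDiffAt (hs.mem_nhds hx)
  obtain ⟨K, v, hv, hK⟩ := hGx.exists_lipschitzOnWith
  have hK' := holderOnWith_one.mpr hK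
  have h := hC.comp (hK'.mono (inter_subset_left (t := G ⁻¹' u))) (fun y hy => hy.2)
  rw [mul_one] at h
  exact ⟨_, v ∩ G ⁻¹' u, mem_nhdsWithin_of_mem_nhds
    (Filter.inter_mem hv (hGx.continuousAt hu)), h⟩

variable [NormedSpace ℝ E] [NormedSpace ℝ E']

lemma LocHolderOn.contDiffAt_comp {f : Pt n → E} {φ : E → E'} (hf : LocHolderOn α s f)
    (hfc : ContinuousOn f s) (hφ : ∀ x ∈ s, ContDiffAt ℝ 1 φ (f x)) :
    LocHolderOn α s (fun x => φ (f x)) := by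
  intro x hx
  obtain ⟨C, t, ht, hC⟩ := hf x hx
  obtain ⟨K, u, hu, hK⟩ := (hφ x hx).exists_lipschitzOnWith
  have hK' := holderOnWith_one.mpr hK
  have h := hK'.comp (hC.mono (inter_subset_left (t := f ⁻¹' u))) (fun y hy => hy.2)
  rw [one_mul] at h
  exact ⟨_, t ∩ f ⁻¹' u, Filter.inter_mem ht (hfc x hx hu), h⟩

lemma LocHolderOn.clm_comp {f : Pt n → E} (φ : E →L[ℝ] E') (hf : LocHolderOn α s f) :
    LocHolderOn α s (fun x => φ (f x)) := by
  intro x hx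
  obtain ⟨C, t, ht, hC⟩ := hf x hx
  have hK := (holderWith_one.mpr φ.lipschitz).comp_holderOnWith hC
  rw [one_mul] at hK
  exact ⟨_, t, ht, hK⟩

lemma LocHolderOn.add {f f' : Pt n → E} (hf : LocHolderOn α s f) (hf' : LocHolderOn α s f') :
    LocHolderOn α s (fun x => f x + f' x) :=
  (hf.prodMk hf').clm_comp (ContinuousLinearMap.fst ℝ E E + ContinuousLinearMap.snd ℝ E E)

lemma LocHolderOn.sum {ι : Type*} (u : Finset ι) {f : ι → Pt n → E}
    (hf : ∀ i ∈ u, LocHolderOn α s (f i)) : LocHolderOn α s (fun x => ∑ i ∈ u, f i x) := by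
  classical
  induction u using Finset.induction_on with
  | empty => simpa using locHolderOn_const (0 : E)
  | insert i u hi ih =>
    simp only [Finset.sum_insert hi]
    exact (hf i (by simp)).add (ih fun j hj => hf j (by simp [hj]))

lemma LocHolderOn.of_contDiffOn {f : Pt n → E} (hs : IsOpen s) (hα : α < 1)
    (hf : ContDiffOn ℝ 1 f s) : LocHolderOn α s f := by
  intro x hx
  obtain ⟨K, t, ht, hK⟩ := (hf.contDiffAt (hs.mem_nhds hx)).exists_lipschitzOnWith
  obtain ⟨C, hC⟩ := LipschitzOnWith.exists_holderOnWith (t := t ∩ Metric.eball x (1 / 2)) hα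
    (hK.mono inter_subset_left) (fun y hy z hz => by
      have h1 := hy.2
      have h2 := hz.2
      rw [Metric.mem_eball] at h1 h2
      calc edist y z ≤ edist y x + edist z x := edist_triangle_right _ _ _
        _ ≤ 1 / 2 + 1 / 2 := add_le_add h1.le h2.le
        _ = 1 := ENNReal.add_halves 1)
  exact ⟨C, _, mem_nhdsWithin_of_mem_nhds
    (Filter.inter_mem ht (Metric.eball_mem_nhds x (by simp))), hC⟩

end LocallyHolder

section CoordinateDerivatives

variable {n : ℕ} {s : Set (Pt n)}

lemma fderiv_eq_sum_pd (f : Pt n → ℝ) (x : Pt n) :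
    fderiv ℝ f x = ∑ a, (pd a f x) • (ContinuousLinearMap.proj a : Pt n →L[ℝ] ℝ) := by
  ext v
  have hv : v = ∑ a, v a • (Pi.single a (1 : ℝ) : Pt n) := by
    ext i
    simp [Finset.sum_apply, Pi.single_apply]
  conv_lhs => rw [hv]
  simp [pd, map_sum, mul_comm]

lemma pd_congr {f f' : Pt n → ℝ} (hs : IsOpen s) (h : EqOn f f' s) (a : Fin n) :
    EqOn (pd a f) (pd a f') s := by
  intro x hx
  unfold pd
  rw [Filter.EventuallyEq.fderiv_eq (h.eventuallyEq_of_mem (hs.mem_nhds hx))]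

lemma pd_add {f f' : Pt n → ℝ} {x : Pt n} (hf : DifferentiableAt ℝ f x)
    (hf' : DifferentiableAt ℝ f' x) (a : Fin n) :
    pd a (fun y => f y + f' y) x = pd a f x + pd a f' x := by
  unfold pd
  rw [fderiv_fun_add hf hf']
  rfl

lemma pd_sum {ι : Type*} (u : Finset ι) {f : ι → Pt n → ℝ} {x : Pt n}
    (hf : ∀ i ∈ u, DifferentiableAt ℝ (f i) x) (a : Fin n) :
    pd a (fun y => ∑ i ∈ u, f i y) x = ∑ i ∈ u, pd a (f i) x := by
  unfold pd
  rw [fderiv_fun_sum hf]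
  simp

lemma pd_mul {f f' : Pt n → ℝ} {x : Pt n} (hf : DifferentiableAt ℝ f x)
    (hf' : DifferentiableAt ℝ f' x) (a : Fin n) :
    pd a (fun y => f y * f' y) x = pd a f x * f' x + f x * pd a f' x := by
  unfold pd
  rw [fderiv_fun_mul hf hf']
  simp
  ring

lemma pd_inv {f : Pt n → ℝ} {x : Pt n} (hf : DifferentiableAt ℝ f x) (h0 : f x ≠ 0)
    (a : Fin n) : pd a (fun y => (f y)⁻¹) x = -1 * (pd a f x * ((f x)⁻¹ * (f x)⁻¹)) := by
  unfold pd
  have h : HasFDerivAt (fun y => (f y)⁻¹) _ x :=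
    (hasDerivAt_inv h0).comp_hasFDerivAt x hf.hasFDerivAt
  rw [h.fderiv]
  simp
  field_simp

lemma pd_const (v : ℝ) (a : Fin n) (x : Pt n) : pd a (fun _ => v) x = 0 := by
  simp [pd]

lemma pd_coord (a b : Fin n) (x : Pt n) :
    pd a (fun y => y b) x = if b = a then 1 else 0 := by
  unfold pd
  rw [(hasFDerivAt_apply b x).fderiv]
  simp [Pi.single_apply]

lemma pd_comp {f : Pt n → ℝ} {G : Pt n → Pt n} {x : Pt n} (hf : DifferentiableAt ℝ f (G x))
    (hG : ∀ i, DifferentiableAt ℝ (fun y => G y i) x) (a : Fin n) :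
    pd a (fun y => f (G y)) x = ∑ i, pd i f (G x) * pd a (fun y => G y i) x := by
  have hG' : DifferentiableAt ℝ G x := differentiableAt_pi.mpr hG
  have h1 : fderiv ℝ (fun y => f (G y)) x = (fderiv ℝ f (G x)).comp (fderiv ℝ G x) :=
    fderiv_comp x hf hG'
  have h2 : ∀ i, pd a (fun y => G y i) x = fderiv ℝ G x (Pi.single a 1) i := by
    intro i
    unfold pd
    rw [fderiv_pi hG]
    rfl
  simp only [h2]
  rw [pd, h1, ContinuousLinearMap.comp_apply, fderiv_eq_sum_pd f]
  simp

lemma ContDiffOn.pd {f : Pt n → ℝ} {m : ℕ} (hs : IsOpen s)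
    (hf : ContDiffOn ℝ ((m + 1 : ℕ) : WithTop ℕ∞) f s) (a : Fin n) :
    ContDiffOn ℝ m (pd a f) s := by
  have := hf.fderiv_of_isOpen (m := m) hs (by norm_cast)
  exact this.clm_apply contDiffOn_const

lemma pd_comm {f : Pt n → ℝ} (hs : IsOpen s) (hf : ContDiffOn ℝ 2 f s) (a b : Fin n)
    {x : Pt n} (hx : x ∈ s) : pd a (pd b f) x = pd b (pd a f) x := by
  have hfx := hf.contDiffAt (hs.mem_nhds hx)
  have hd : DifferentiableAt ℝ (fderiv ℝ f) x :=
    (hfx.fderiv_right (m := 1) (by norm_num)).differentiableAt one_ne_zero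
  have key : ∀ a b : Fin n, pd a (pd b f) x
      = fderiv ℝ (fderiv ℝ f) x (Pi.single a 1) (Pi.single b 1) := by
    intro a b
    have : pd b f = fun y => (fderiv ℝ f y) (Pi.single b 1) := rfl
    rw [this, pd, fderiv_clm_apply hd (differentiableAt_const _)]
    simp
  rw [key, key]
  exact (hfx.isSymmSndFDerivAt (by simp)) _ _

end CoordinateDerivatives

section HolderClass

variable {n k : ℕ} {α : ℝ} {s : Set (Pt n)} {f f' : Pt n → ℝ}

lemma CHolderOn.congr (hf : CHolderOn k α s f) (h : EqOn f' f s) : CHolderOn k α s f' :=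
  ⟨hf.1.congr h, LocHolderOn.congr hf.2 fun _ hx => iteratedFDerivWithin_congr h hx k⟩

lemma cHolderOn_zero_iff : CHolderOn 0 α s f ↔ ContinuousOn f s ∧ LocHolderOn α s f := by
  have h1 : ContDiffOn ℝ ((0 : ℕ) : WithTop ℕ∞) f s ↔ ContinuousOn f s := by
    rw [Nat.cast_zero, contDiffOn_zero]
  have h2 : LocHolderOn α s (iteratedFDerivWithin ℝ 0 f s) ↔ LocHolderOn α s f := by
    constructor
    · intro h
      refine (h.clm_comp (continuousMultilinearCurryFin0 ℝ
        (Pt n) ℝ).toContinuousLinearEquiv.toContinuousLinearMap).congr fun x _ => ?_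
      simp [iteratedFDerivWithin_zero_eq_comp]
    · intro h
      exact h.clm_comp (continuousMultilinearCurryFin0 ℝ
        (Pt n) ℝ).symm.toContinuousLinearEquiv.toContinuousLinearMap
  exact and_congr h1 h2

lemma cHolderOn_succ_iff (hs : IsOpen s) :
    CHolderOn (k + 1) α s f ↔ DifferentiableOn ℝ f s ∧ ∀ a, CHolderOn k α s (pd a f) := by
  let L : Fin n → ℝ →L[ℝ] (Pt n →L[ℝ] ℝ) := fun a =>
    ContinuousLinearMap.smulRight (1 : ℝ →L[ℝ] ℝ) (ContinuousLinearMap.proj a : Pt n →L[ℝ] ℝ)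
  have hd : fderiv ℝ f = fun x => ∑ a, L a (pd a f x) := by
    funext x
    rw [fderiv_eq_sum_pd]
    simp [L]
  have hsucc : ∀ x ∈ s, iteratedFDerivWithin ℝ (k + 1) f s x =
      (continuousMultilinearCurryRightEquiv' ℝ k (Pt n) ℝ).symm
        (iteratedFDerivWithin ℝ k (fderiv ℝ f) s x) := by
    intro x hx
    rw [iteratedFDerivWithin_succ_eq_comp_right hs.uniqueDiffOn hx, Function.comp_apply]
    congr 1
    exact iteratedFDerivWithin_congr (fun y hy => fderivWithin_of_isOpen hs hy) hx k
  constructor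
  · rintro ⟨hc, hh⟩
    push_cast at hc
    rw [contDiffOn_succ_iff_fderiv_of_isOpen hs] at hc
    refine ⟨hc.1, fun a => ⟨hc.2.2.clm_apply contDiffOn_const, ?_⟩⟩
    have h1 : LocHolderOn α s (iteratedFDerivWithin ℝ k (fderiv ℝ f) s) := by
      refine (LocHolderOn.clm_comp (continuousMultilinearCurryRightEquiv' ℝ k
        (Pt n) ℝ).toContinuousLinearEquiv.toContinuousLinearMap hh).congr fun x hx => ?_
      simp [hsucc x hx]
    let L : (Pt n →L[ℝ] ℝ) →L[ℝ] ℝ := ContinuousLinearMap.apply ℝ ℝ (Pi.single a 1)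
    refine (h1.clm_comp (ContinuousLinearMap.compContinuousMultilinearMapL ℝ
      (fun _ : Fin k => Pt n) _ _ L)).congr fun x hx => ?_
    exact L.iteratedFDerivWithin_comp_left (hc.2.2 x hx) hs.uniqueDiffOn hx le_rfl
  · rintro ⟨hdf, hp⟩
    have hterm : ∀ a ∈ Finset.univ, ContDiffOn ℝ k (fun x => L a (pd a f x)) s := fun a _ =>
      (L a).contDiff.comp_contDiffOn (hp a).1
    refine ⟨?_, ?_⟩
    · push_cast
      rw [contDiffOn_succ_iff_fderiv_of_isOpen hs]
      refine ⟨hdf, by simp, ?_⟩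
      rw [hd]
      exact ContDiffOn.sum hterm
    · have h1 : LocHolderOn α s (iteratedFDerivWithin ℝ k (fderiv ℝ f) s) := by
        let M := fun a => ContinuousLinearMap.compContinuousMultilinearMapL ℝ
          (fun _ : Fin k => Pt n) ℝ (Pt n →L[ℝ] ℝ) (L a)
        have h2 := fun a => LocHolderOn.clm_comp
          (E' := ContinuousMultilinearMap ℝ (fun _ : Fin k => Pt n) (Pt n →L[ℝ] ℝ)) (M a) (hp a).2
        refine (LocHolderOn.sum Finset.univ fun a _ => h2 a).congr fun x hx => ?_
        rw [hd, iteratedFDerivWithin_fun_sum_apply hs.uniqueDiffOn hx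
          (fun a ha => hterm a ha x hx)]
        refine Finset.sum_congr rfl fun a _ => ?_
        exact (L a).iteratedFDerivWithin_comp_left ((hp a).1 x hx)
          hs.uniqueDiffOn hx le_rfl
      exact (h1.clm_comp (continuousMultilinearCurryRightEquiv' ℝ k
        (Pt n) ℝ).symm.toContinuousLinearEquiv.toContinuousLinearMap).congr
          (f := fun x => (continuousMultilinearCurryRightEquiv' ℝ k (Pt n) ℝ).symm
            (iteratedFDerivWithin ℝ k (fderiv ℝ f) s x)) hsucc

lemma CHolderOn.of_contDiffOn (hs : IsOpen s) (hα : α < 1)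
    (hf : ContDiffOn ℝ ((k + 1 : ℕ) : WithTop ℕ∞) f s) : CHolderOn k α s f := by
  induction k generalizing f with
  | zero =>
    have hf' : ContDiffOn ℝ 1 f s := by simpa using hf
    exact cHolderOn_zero_iff.mpr ⟨hf'.continuousOn, LocHolderOn.of_contDiffOn hs hα hf'⟩
  | succ k ih =>
    exact (cHolderOn_succ_iff hs).mpr
      ⟨hf.differentiableOn (by simp), fun a => ih (ContDiffOn.pd hs hf a)⟩

lemma CHolderOn.of_le (hs : IsOpen s) (hα : α < 1) {j : ℕ} (hf : CHolderOn k α s f)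
    (hj : j ≤ k) : CHolderOn j α s f := by
  rcases hj.eq_or_lt with rfl | hlt
  · exact hf
  · exact CHolderOn.of_contDiffOn hs hα (hf.1.of_le (by exact_mod_cast hlt))

lemma CHolderOn.pd (hs : IsOpen s) (hf : CHolderOn (k + 1) α s f) (a : Fin n) :
    CHolderOn k α s (pd a f) :=
  ((cHolderOn_succ_iff hs).mp hf).2 a

lemma CHolderOn.differentiableAt (hs : IsOpen s) (hf : CHolderOn (k + 1) α s f) {x : Pt n}
    (hx : x ∈ s) : DifferentiableAt ℝ f x :=
  (((cHolderOn_succ_iff hs).mp hf).1 x hx).differentiableAt (hs.mem_nhds hx)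

lemma cHolderOn_const (hs : IsOpen s) (hα : α < 1) (v : ℝ) : CHolderOn k α s fun _ => v :=
  CHolderOn.of_contDiffOn hs hα contDiffOn_const

lemma CHolderOn.add (hs : IsOpen s) (hf : CHolderOn k α s f) (hf' : CHolderOn k α s f') :
    CHolderOn k α s fun x => f x + f' x := by
  induction k generalizing f f' with
  | zero =>
    rw [cHolderOn_zero_iff] at *
    exact ⟨hf.1.add hf'.1, hf.2.add hf'.2⟩
  | succ k ih =>
    refine (cHolderOn_succ_iff hs).mpr ⟨fun x hx => ((hf.differentiableAt hs hx).add
      (hf'.differentiableAt hs hx)).differentiableWithinAt, fun a => ?_⟩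
    exact (ih (hf.pd hs a) (hf'.pd hs a)).congr fun x hx =>
      pd_add (hf.differentiableAt hs hx) (hf'.differentiableAt hs hx) a

lemma CHolderOn.mul (hs : IsOpen s) (hα : α < 1) (hf : CHolderOn k α s f)
    (hf' : CHolderOn k α s f') : CHolderOn k α s fun x => f x * f' x := by
  induction k generalizing f f' with
  | zero =>
    rw [cHolderOn_zero_iff] at *
    exact ⟨hf.1.mul hf'.1, (hf.2.prodMk hf'.2).contDiffAt_comp (φ := fun p : ℝ × ℝ => p.1 * p.2)
      (hf.1.prodMk hf'.1) fun x _ => contDiffAt_fst.mul contDiffAt_snd⟩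
  | succ k ih =>
    refine (cHolderOn_succ_iff hs).mpr ⟨fun x hx => ((hf.differentiableAt hs hx).mul
      (hf'.differentiableAt hs hx)).differentiableWithinAt, fun a => ?_⟩
    exact ((ih (hf.pd hs a) (hf'.of_le hs hα k.le_succ)).add hs
      (ih (hf.of_le hs hα k.le_succ) (hf'.pd hs a))).congr fun x hx =>
        pd_mul (hf.differentiableAt hs hx) (hf'.differentiableAt hs hx) a

lemma CHolderOn.const_mul (hs : IsOpen s) (hα : α < 1) (v : ℝ) (hf : CHolderOn k α s f) :
    CHolderOn k α s fun x => v * f x :=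
  (cHolderOn_const hs hα v).mul hs hα hf

lemma CHolderOn.sub (hs : IsOpen s) (hα : α < 1) (hf : CHolderOn k α s f)
    (hf' : CHolderOn k α s f') : CHolderOn k α s fun x => f x - f' x :=
  (hf.add hs (hf'.const_mul hs hα (-1))).congr fun x _ => by ring

lemma CHolderOn.inv (hs : IsOpen s) (hα : α < 1) (hf : CHolderOn k α s f)
    (h0 : ∀ x ∈ s, f x ≠ 0) : CHolderOn k α s fun x => (f x)⁻¹ := by
  induction k with
  | zero =>
    rw [cHolderOn_zero_iff] at *
    exact ⟨hf.1.inv₀ h0, hf.2.contDiffAt_comp (φ := fun y : ℝ => y⁻¹) hf.1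
      fun x hx => contDiffAt_inv ℝ (h0 x hx)⟩
  | succ k ih =>
    refine (cHolderOn_succ_iff hs).mpr ⟨fun x hx => ((hf.differentiableAt hs hx).inv
      (h0 x hx)).differentiableWithinAt, fun a => ?_⟩
    have hi := ih (hf.of_le hs hα k.le_succ)
    exact (((hf.pd hs a).mul hs hα (hi.mul hs hα hi)).const_mul hs hα (-1)).congr fun x hx =>
      pd_inv (hf.differentiableAt hs hx) (h0 x hx) a

lemma CHolderOn.sum (hs : IsOpen s) (hα : α < 1) {ι : Type*} (u : Finset ι)
    {f : ι → Pt n → ℝ} (hf : ∀ i ∈ u, CHolderOn k α s (f i)) :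
    CHolderOn k α s fun x => ∑ i ∈ u, f i x := by
  classical
  induction u using Finset.induction_on with
  | empty => simpa using cHolderOn_const hs hα 0
  | insert i u hi ih =>
    simp only [Finset.sum_insert hi]
    exact (hf i (by simp)).add hs (ih fun j hj => hf j (by simp [hj]))

lemma CHolderOn.prod (hs : IsOpen s) (hα : α < 1) {ι : Type*} (u : Finset ι)
    {f : ι → Pt n → ℝ} (hf : ∀ i ∈ u, CHolderOn k α s (f i)) :
    CHolderOn k α s fun x => ∏ i ∈ u, f i x := by
  classical
  induction u using Finset.induction_on with
  | empty => simpa using cHolderOn_const hs hα 1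
  | insert i u hi ih =>
    simp only [Finset.prod_insert hi]
    exact (hf i (by simp)).mul hs hα (ih fun j hj => hf j (by simp [hj]))

lemma CHolderOn.comp {t : Set (Pt n)} {G : Pt n → Pt n} (hs : IsOpen s) (ht : IsOpen t)
    (hα : α < 1) (hf : CHolderOn k α t f) (hG : ∀ i, CHolderOn k α s fun x => G x i)
    (hG1 : ∀ i, ContDiffOn ℝ 1 (fun x => G x i) s) (hGt : MapsTo G s t) :
    CHolderOn k α s fun x => f (G x) := by
  have hGc : ContDiffOn ℝ 1 G s := contDiffOn_pi.mpr hG1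
  induction k generalizing f with
  | zero =>
    rw [cHolderOn_zero_iff] at hf ⊢
    exact ⟨hf.1.comp hGc.continuousOn hGt, hf.2.comp_contDiffOn hs ht hGc hGt⟩
  | succ k ih =>
    have hGd : ∀ x ∈ s, ∀ i, DifferentiableAt ℝ (fun y => G y i) x := fun x hx i =>
      (hG i).differentiableAt hs hx
    refine (cHolderOn_succ_iff hs).mpr ⟨fun x hx => (DifferentiableAt.comp x
      (hf.differentiableAt ht (hGt hx))
      (differentiableAt_pi.mpr (hGd x hx))).differentiableWithinAt, fun a => ?_⟩
    exact (CHolderOn.sum hs hα Finset.univ fun i _ =>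
      (ih (hf.pd ht i) fun j => (hG j).of_le hs hα k.le_succ).mul hs hα
        ((hG i).pd hs a)).congr fun x hx =>
      pd_comp (hf.differentiableAt ht (hGt hx)) (hGd x hx) a

lemma CHolderOn.det (hs : IsOpen s) (hα : α < 1) {A : Pt n → Matrix (Fin n) (Fin n) ℝ}
    (hA : ∀ i j, CHolderOn k α s fun x => A x i j) : CHolderOn k α s fun x => (A x).det := by
  simp only [Matrix.det_apply']
  exact CHolderOn.sum hs hα _ fun σ _ =>
    (CHolderOn.prod hs hα _ fun i _ => hA _ _).const_mul hs hα _

lemma CHolderOn.matrix_inv (hs : IsOpen s) (hα : α < 1)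
    {A : Pt n → Matrix (Fin n) (Fin n) ℝ} (hA : ∀ i j, CHolderOn k α s fun x => A x i j)
    (hu : ∀ x ∈ s, IsUnit (A x)) (i j : Fin n) : CHolderOn k α s fun x => (A x)⁻¹ i j := by
  have hdet : ∀ x ∈ s, (A x).det ≠ 0 := fun x hx =>
    ((Matrix.isUnit_iff_isUnit_det _).mp (hu x hx)).ne_zero
  have hadj : CHolderOn k α s fun x => (A x).adjugate i j := by
    simp only [Matrix.adjugate_apply]
    refine CHolderOn.det hs hα fun p q => ?_
    by_cases hp : p = j
    · simpa [Matrix.updateRow_apply, hp] using cHolderOn_const hs hα _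
    · simpa [Matrix.updateRow_apply, hp] using hA p q
  refine (((CHolderOn.det hs hα hA).inv hs hα hdet).mul hs hα hadj).congr fun x hx => ?_
  simp [Matrix.inv_def]

end HolderClass

section ConformalSystem

variable {n : ℕ} {U V : Set (Pt n)} {g h : Met n} {F : Pt n → Pt n} {c : Pt n → ℝ}

/-- The matrix `h(F) DF`. -/
def loweredJac (h : Met n) (F : Pt n → Pt n) (p d : Fin n) (x : Pt n) : ℝ :=
  ∑ q, h (F x) p q * pd d (fun y => F y q) x

/-- The part of `∂_e (F^* h)_{ab}` in which the derivative falls on `h`. -/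
def pullbackDeriv (h : Met n) (F : Pt n → Pt n) (e a b : Fin n) (x : Pt n) : ℝ :=
  ∑ p, ∑ q, pd a (fun y => F y p) x *
    (∑ r, pd r (fun z => h z p q) (F x) * pd e (fun y => F y r) x) * pd b (fun y => F y q) x

/-- The part of the Koszul combination of `∂(c g) = ∂(F^* h)` which contains neither derivatives
of `c` nor second derivatives of `F`. -/
def koszulRemainder (g h : Met n) (F : Pt n → Pt n) (c : Pt n → ℝ) (a b d : Fin n) (x : Pt n) :
    ℝ :=
  c x * (pd a (fun y => g y b d) x + pd b (fun y => g y a d) x - pd d (fun y => g y a b) x)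
    - (pullbackDeriv h F a b d x + pullbackDeriv h F b a d x - pullbackDeriv h F d a b x)

lemma conformal_entry {x : Pt n} (hx : (jac F x)ᵀ * h (F x) * jac F x = c x • g x)
    (a b : Fin n) :
    ∑ p, ∑ q, pd a (fun y => F y p) x * h (F x) p q * pd b (fun y => F y q) x
      = c x * g x a b := by
  have := congrFun (congrFun hx a) b
  simp only [Matrix.mul_apply, Matrix.transpose_apply, Matrix.smul_apply, smul_eq_mul,
    Finset.sum_mul] at this
  rw [← this, Finset.sum_comm]
  rfl

lemma pd_conformal (hU : IsOpen U) (hV : IsOpen V) (hFmaps : MapsTo F U V)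
    (hF : ∀ i, ContDiffOn ℝ 2 (fun x => F x i) U)
    (hg : ∀ a b, DifferentiableOn ℝ (fun x => g x a b) U)
    (hh : ∀ a b, DifferentiableOn ℝ (fun x => h x a b) V) (hc : DifferentiableOn ℝ c U)
    (hconf : ∀ x ∈ U, (jac F x)ᵀ * h (F x) * jac F x = c x • g x) {x : Pt n} (hx : x ∈ U)
    (e a b : Fin n) :
    ∑ p, pd e (pd a fun y => F y p) x * loweredJac h F p b x + pullbackDeriv h F e a b x
      + ∑ p, ∑ q, pd a (fun y => F y p) x * h (F x) p q * pd e (pd b fun y => F y q) x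
      = pd e c x * g x a b + c x * pd e (fun y => g y a b) x := by
  have hFd : ∀ i, DifferentiableAt ℝ (fun y => F y i) x := fun i =>
    ((hF i).contDiffAt (hU.mem_nhds hx)).differentiableAt (by norm_num)
  have hpF : ∀ i a, DifferentiableAt ℝ (pd a fun y => F y i) x := fun i a =>
    ((ContDiffOn.pd (m := 1) hU (hF i) a).contDiffAt (hU.mem_nhds hx)).differentiableAt
      (by norm_num)
  have hhd : ∀ p q, DifferentiableAt ℝ (fun z => h z p q) (F x) := fun p q =>
    (hh p q).differentiableAt (hV.mem_nhds (hFmaps hx))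
  have hhF : ∀ p q, DifferentiableAt ℝ (fun y => h (F y) p q) x := fun p q =>
    DifferentiableAt.comp x (hhd p q) (differentiableAt_pi.mpr hFd)
  have hL := pd_congr hU (fun y hy => conformal_entry (hconf y hy) a b) e hx
  rw [pd_mul (hc.differentiableAt (hU.mem_nhds hx))
    ((hg a b).differentiableAt (hU.mem_nhds hx))] at hL
  rw [← hL, pd_sum _ fun p _ => DifferentiableAt.fun_sum fun q _ =>
    ((hpF p a).fun_mul (hhF p q)).fun_mul (hpF q b)]
  unfold loweredJac pullbackDeriv
  rw [← Finset.sum_add_distrib, ← Finset.sum_add_distrib]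
  refine Finset.sum_congr rfl fun p _ => ?_
  rw [pd_sum _ fun q _ => ((hpF p a).fun_mul (hhF p q)).fun_mul (hpF q b), Finset.mul_sum,
    ← Finset.sum_add_distrib, ← Finset.sum_add_distrib]
  refine Finset.sum_congr rfl fun q _ => ?_
  rw [pd_mul ((hpF p a).fun_mul (hhF p q)) (hpF q b), pd_mul (hpF p a) (hhF p q),
    pd_comp (hhd p q) hFd]
  ring

lemma conformal_koszul (hU : IsOpen U) (hV : IsOpen V) (hFmaps : MapsTo F U V)
    (hF : ∀ i, ContDiffOn ℝ 2 (fun x => F x i) U)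
    (hg : ∀ a b, DifferentiableOn ℝ (fun x => g x a b) U)
    (hh : ∀ a b, DifferentiableOn ℝ (fun x => h x a b) V) (hc : DifferentiableOn ℝ c U)
    (hhs : ∀ x ∈ V, (h x).IsSymm)
    (hconf : ∀ x ∈ U, (jac F x)ᵀ * h (F x) * jac F x = c x • g x) {x : Pt n} (hx : x ∈ U)
    (a b d : Fin n) :
    2 * ∑ p, pd a (pd b fun y => F y p) x * loweredJac h F p d x
      = pd a c x * g x b d + pd b c x * g x a d - pd d c x * g x a b
        + koszulRemainder g h F c a b d x := by
  have key := fun e a b => pd_conformal hU hV hFmaps hF hg hh hc hconf hx e a b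
  have hsw : ∀ e a b : Fin n,
      ∑ p, ∑ q, pd a (fun y => F y p) x * h (F x) p q * pd e (pd b fun y => F y q) x
        = ∑ p, pd e (pd b fun y => F y p) x * loweredJac h F p a x := by
    intro e a b
    rw [Finset.sum_comm]
    unfold loweredJac
    refine Finset.sum_congr rfl fun q _ => ?_
    rw [Finset.mul_sum]
    refine Finset.sum_congr rfl fun p _ => ?_
    rw [(hhs _ (hFmaps hx)).apply q p]
    ring
  have hcomm : ∀ e a d : Fin n, ∑ p, pd e (pd a fun y => F y p) x * loweredJac h F p d x
      = ∑ p, pd a (pd e fun y => F y p) x * loweredJac h F p d x := fun e a d =>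
    Finset.sum_congr rfl fun p _ => by rw [pd_comm hU (hF p) e a hx]
  have k1 := key a b d
  have k2 := key b a d
  have k3 := key d a b
  rw [hsw] at k1 k2 k3
  rw [hcomm b a d] at k2
  rw [hcomm d a b, hcomm d b a] at k3
  unfold koszulRemainder
  linarith

/-- The part of the integrability condition of `conformal_koszul` which contains no second
derivatives of `c`. -/
def integrabilityRemainder (g h : Met n) (F : Pt n → Pt n) (c : Pt n → ℝ) (e a b d : Fin n)
    (x : Pt n) : ℝ :=
  (2 * ∑ p, pd a (pd b fun y => F y p) x * pd e (loweredJac h F p d) x)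
    - (pd a c x * pd e (fun y => g y b d) x + pd b c x * pd e (fun y => g y a d) x
      - pd d c x * pd e (fun y => g y a b) x + pd e (koszulRemainder g h F c a b d) x)

lemma pd_conformal_koszul (hU : IsOpen U)
    (hF : ∀ i, ContDiffOn ℝ 3 (fun x => F x i) U)
    (hg : ∀ a b, DifferentiableOn ℝ (fun x => g x a b) U) (hc : ContDiffOn ℝ 2 c U)
    (hW : ∀ p d, DifferentiableOn ℝ (loweredJac h F p d) U)
    (hZ : ∀ a b d, DifferentiableOn ℝ (koszulRemainder g h F c a b d) U)
    (hK : ∀ x ∈ U, ∀ a b d, 2 * ∑ p, pd a (pd b fun y => F y p) x * loweredJac h F p d x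
      = pd a c x * g x b d + pd b c x * g x a d - pd d c x * g x a b
        + koszulRemainder g h F c a b d x)
    {x : Pt n} (hx : x ∈ U) (e a b d : Fin n) :
    2 * ∑ p, pd e (pd a (pd b fun y => F y p)) x * loweredJac h F p d x
        + integrabilityRemainder g h F c e a b d x
      = pd e (pd a c) x * g x b d + pd e (pd b c) x * g x a d - pd e (pd d c) x * g x a b := by
  have hn := hU.mem_nhds hx
  have hψ : ∀ a, DifferentiableAt ℝ (pd a c) x := fun a =>
    ((ContDiffOn.pd (m := 1) hU hc a).contDiffAt hn).differentiableAt (by norm_num)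
  have hD : ∀ a b p, DifferentiableAt ℝ (pd a (pd b fun y => F y p)) x := fun a b p =>
    ((ContDiffOn.pd (m := 1) hU (ContDiffOn.pd (m := 2) hU (hF p) b) a).contDiffAt
      hn).differentiableAt (by norm_num)
  have hg' := fun a b => (hg a b).differentiableAt hn
  have hW' := fun a b => (hW a b).differentiableAt hn
  have hZ' := fun a b d => (hZ a b d).differentiableAt hn
  have h1 : ∀ a b d : Fin n, DifferentiableAt ℝ (fun y => pd a c y * g y b d) x :=
    fun a b d => (hψ a).mul (hg' b d)
  have hL := pd_congr hU (f := fun y => 2 * ∑ p, pd a (pd b fun y => F y p) y *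
      loweredJac h F p d y)
    (f' := fun y => pd a c y * g y b d + pd b c y * g y a d + -1 * (pd d c y * g y a b)
        + koszulRemainder g h F c a b d y)
    (fun y hy => (hK y hy a b d).trans (by ring)) e hx
  have hS : ∀ p ∈ Finset.univ, DifferentiableAt ℝ
      (fun y => pd a (pd b fun y => F y p) y * loweredJac h F p d y) x :=
    fun p _ => (hD a b p).mul (hW' p d)
  rw [pd_mul (differentiableAt_const _) (DifferentiableAt.fun_sum hS), pd_sum _ hS, pd_const,
    pd_add (((h1 _ _ _).fun_add (h1 _ _ _)).fun_add ((differentiableAt_const _).fun_mul (h1 _ _ _)))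
      (hZ' a b d),
    pd_add ((h1 _ _ _).fun_add (h1 _ _ _)) ((differentiableAt_const _).fun_mul (h1 _ _ _)),
    pd_add (h1 _ _ _) (h1 _ _ _), pd_mul (differentiableAt_const _) (h1 _ _ _),
    pd_mul (hψ _) (hg' _ _), pd_mul (hψ _) (hg' _ _), pd_mul (hψ _) (hg' _ _), pd_const] at hL
  have hS' : ∑ p, pd e (fun y => pd a (pd b fun y => F y p) y * loweredJac h F p d y) x
      = ∑ p, pd e (pd a (pd b fun y => F y p)) x * loweredJac h F p d x
        + ∑ p, pd a (pd b fun y => F y p) x * pd e (loweredJac h F p d) x := by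
    rw [← Finset.sum_add_distrib]
    exact Finset.sum_congr rfl fun p _ => pd_mul (hD a b p) (hW' p d) e
  rw [hS'] at hL
  unfold integrabilityRemainder
  linarith

/-- The Kulkarni–Nomizu type map `H ↦ g ∧ H` is injective in dimension at least three, with an
explicit left inverse. -/
lemma kulkarniNomizu_solve (hn : 3 ≤ n) {G I H : Matrix (Fin n) (Fin n) ℝ}
    {K : Fin n → Fin n → Fin n → Fin n → ℝ} (hIG : I * G = 1)
    (hK : ∀ e a b d, H e b * G a d - H e d * G a b - H a b * G e d + H a d * G e b = K e a b d)
    (e b : Fin n) :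
    H e b = ((n : ℝ) - 2)⁻¹ * ((∑ a, ∑ d, I d a * K e a b d)
      - G e b * ((2 * (n : ℝ) - 2)⁻¹ * ∑ b, ∑ e, I b e * ∑ a, ∑ d, I d a * K e a b d)) := by
  have hGI : G * I = 1 := mul_eq_one_comm.mp hIG
  have hIG' : ∀ i j, ∑ a, I i a * G a j = if i = j then 1 else 0 := fun i j => by
    rw [← Matrix.mul_apply, hIG, Matrix.one_apply]
  have hGI' : ∀ i j, ∑ a, G i a * I a j = if i = j then 1 else 0 := fun i j => by
    rw [← Matrix.mul_apply, hGI, Matrix.one_apply]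
  set τ := ∑ a, ∑ d, I d a * H a d with hτ
  have hk : ∀ e b, ∑ a, ∑ d, I d a * K e a b d = ((n : ℝ) - 2) * H e b + G e b * τ := by
    intro e b
    have t1 : ∑ a, ∑ d, I d a * (H e b * G a d) = n * H e b := by
      rw [Finset.sum_comm]
      calc ∑ d, ∑ a, I d a * (H e b * G a d) = ∑ d, H e b * ∑ a, I d a * G a d := by
            refine Finset.sum_congr rfl fun d _ => ?_
            rw [Finset.mul_sum]
            exact Finset.sum_congr rfl fun a _ => by ring
        _ = n * H e b := by simp [hIG']
    have t2 : ∑ a, ∑ d, I d a * (H e d * G a b) = H e b := by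
      rw [Finset.sum_comm]
      calc ∑ d, ∑ a, I d a * (H e d * G a b) = ∑ d, H e d * ∑ a, I d a * G a b := by
            refine Finset.sum_congr rfl fun d _ => ?_
            rw [Finset.mul_sum]
            exact Finset.sum_congr rfl fun a _ => by ring
        _ = H e b := by simp [hIG']
    have t3 : ∑ a, ∑ d, I d a * (H a b * G e d) = H e b := by
      calc ∑ a, ∑ d, I d a * (H a b * G e d) = ∑ a, H a b * ∑ d, G e d * I d a := by
            refine Finset.sum_congr rfl fun d _ => ?_
            rw [Finset.mul_sum]
            exact Finset.sum_congr rfl fun a _ => by ring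
        _ = H e b := by simp [hGI']
    have t4 : ∑ a, ∑ d, I d a * (H a d * G e b) = G e b * τ := by
      rw [hτ, Finset.mul_sum]
      refine Finset.sum_congr rfl fun a _ => ?_
      rw [Finset.mul_sum]
      exact Finset.sum_congr rfl fun d _ => by ring
    calc ∑ a, ∑ d, I d a * K e a b d
        = ∑ a, ∑ d, I d a * (H e b * G a d) - ∑ a, ∑ d, I d a * (H e d * G a b)
          - ∑ a, ∑ d, I d a * (H a b * G e d) + ∑ a, ∑ d, I d a * (H a d * G e b) := by
          simp only [← Finset.sum_sub_distrib, ← Finset.sum_add_distrib]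
          refine Finset.sum_congr rfl fun a _ => Finset.sum_congr rfl fun d _ => ?_
          rw [← hK]
          ring
      _ = ((n : ℝ) - 2) * H e b + G e b * τ := by
          rw [t1, t2, t3, t4]
          ring
  have htr : ∑ b, ∑ e, I b e * ∑ a, ∑ d, I d a * K e a b d = (2 * (n : ℝ) - 2) * τ := by
    have s1 : ∑ b, ∑ e, I b e * (((n : ℝ) - 2) * H e b) = ((n : ℝ) - 2) * τ := by
      rw [hτ, Finset.sum_comm, Finset.mul_sum]
      refine Finset.sum_congr rfl fun a _ => ?_
      rw [Finset.mul_sum]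
      exact Finset.sum_congr rfl fun d _ => by ring
    have s2 : ∑ b, ∑ e, I b e * (G e b * τ) = n * τ := by
      calc ∑ b, ∑ e, I b e * (G e b * τ) = ∑ b, (∑ e, I b e * G e b) * τ := by
            refine Finset.sum_congr rfl fun d _ => ?_
            rw [Finset.sum_mul]
            exact Finset.sum_congr rfl fun a _ => by ring
        _ = n * τ := by simp [hIG']
    simp only [hk, mul_add, Finset.sum_add_distrib, s1, s2]
    ring
  have hn' : (3 : ℝ) ≤ n := by exact_mod_cast hn
  have h2 : (n : ℝ) - 2 ≠ 0 := by linarith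
  have h3 : 2 * (n : ℝ) - 2 ≠ 0 := by linarith
  rw [htr, hk, inv_mul_cancel_left₀ h3]
  field_simp
  ring

end ConformalSystem

section Bootstrap

variable {n : ℕ} {α : ℝ} {U V : Set (Pt n)} {g h : Met n} {F : Pt n → Pt n} {c : Pt n → ℝ}

lemma IsMetricOn.isUnit (hg : IsMetricOn g U) {x : Pt n} (hx : x ∈ U) : IsUnit (g x) :=
  (hg x hx).2.isUnit

lemma integrability_conformal (hU : IsOpen U)
    (hF : ∀ i, ContDiffOn ℝ 3 (fun x => F x i) U)
    (hg : ∀ a b, DifferentiableOn ℝ (fun x => g x a b) U) (hc : ContDiffOn ℝ 2 c U)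
    (hW : ∀ p d, DifferentiableOn ℝ (loweredJac h F p d) U)
    (hZ : ∀ a b d, DifferentiableOn ℝ (koszulRemainder g h F c a b d) U)
    (hK : ∀ x ∈ U, ∀ a b d, 2 * ∑ p, pd a (pd b fun y => F y p) x * loweredJac h F p d x
      = pd a c x * g x b d + pd b c x * g x a d - pd d c x * g x a b
        + koszulRemainder g h F c a b d x)
    {x : Pt n} (hx : x ∈ U) (e a b d : Fin n) :
    pd e (pd b c) x * g x a d - pd e (pd d c) x * g x a b - pd a (pd b c) x * g x e d
        + pd a (pd d c) x * g x e b
      = integrabilityRemainder g h F c e a b d x - integrabilityRemainder g h F c a e b d x := by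
  have k1 := pd_conformal_koszul hU hF hg hc hW hZ hK hx e a b d
  have k2 := pd_conformal_koszul hU hF hg hc hW hZ hK hx a e b d
  have h3 : ∀ p, pd e (pd a (pd b fun y => F y p)) x = pd a (pd e (pd b fun y => F y p)) x :=
    fun p => pd_comm hU (ContDiffOn.pd (m := 2) hU (hF p) b) e a hx
  simp only [h3] at k1
  rw [pd_comm hU hc e a hx] at k1
  linarith

lemma cHolderOn_pd_conformalFactor_succ (hn : 3 ≤ n) (hα : α < 1) (hU : IsOpen U) {j : ℕ}
    (hgm : IsMetricOn g U) (hg : MetCHolderOn (j + 1) α U g)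
    (hF3 : ∀ i, ContDiffOn ℝ 3 (fun x => F x i) U)
    (hF : ∀ i, CHolderOn (j + 2) α U fun x => F x i)
    (hc2 : ContDiffOn ℝ 2 c U) (hc : ∀ a, CHolderOn j α U (pd a c))
    (hW : ∀ p d, CHolderOn (j + 1) α U (loweredJac h F p d))
    (hZ : ∀ a b d, CHolderOn (j + 1) α U (koszulRemainder g h F c a b d))
    (hK : ∀ x ∈ U, ∀ a b d, 2 * ∑ p, pd a (pd b fun y => F y p) x * loweredJac h F p d x
      = pd a c x * g x b d + pd b c x * g x a d - pd d c x * g x a b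
        + koszulRemainder g h F c a b d x) (a : Fin n) :
    CHolderOn (j + 1) α U (pd a c) := by
  have hdiff : ∀ {f : Pt n → ℝ}, CHolderOn (j + 1) α U f → DifferentiableOn ℝ f U :=
    fun hf => ((cHolderOn_succ_iff hU).mp hf).1
  have hR : ∀ e a b d, CHolderOn j α U (integrabilityRemainder g h F c e a b d) :=
    fun e a b d => (((CHolderOn.sum hU hα _ fun p _ => ((((hF p).pd hU b).pd hU a).mul hU hα
      ((hW p d).pd hU e))).const_mul hU hα 2)).sub hU hα
      (((((hc a).mul hU hα ((hg b d).pd hU e)).add hU ((hc b).mul hU hα ((hg a d).pd hU e))).sub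
        hU hα ((hc d).mul hU hα ((hg a b).pd hU e))).add hU ((hZ a b d).pd hU e))
  have hg' : ∀ a b, CHolderOn j α U fun x => g x a b := fun a b =>
    (hg a b).of_le hU hα (by omega)
  have hgi : ∀ a b, CHolderOn j α U fun x => (g x)⁻¹ a b :=
    CHolderOn.matrix_inv hU hα hg' fun x hx => hgm.isUnit hx
  have hS : ∀ e b, CHolderOn j α U fun x => ∑ a, ∑ d, (g x)⁻¹ d a *
      (integrabilityRemainder g h F c e a b d x - integrabilityRemainder g h F c a e b d x) :=
    fun e b => CHolderOn.sum hU hα _ fun a _ => CHolderOn.sum hU hα _ fun d _ =>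
      (hgi d a).mul hU hα ((hR e a b d).sub hU hα (hR a e b d))
  rw [cHolderOn_succ_iff hU]
  refine ⟨(ContDiffOn.pd (m := 1) hU hc2 a).differentiableOn (by norm_num), fun e => ?_⟩
  refine (((hS e a).sub hU hα ((hg' e a).mul hU hα ((CHolderOn.sum hU hα Finset.univ fun b _ =>
    CHolderOn.sum hU hα Finset.univ fun e _ => (hgi b e).mul hU hα (hS e b)).const_mul hU hα
      (2 * (n : ℝ) - 2)⁻¹))).const_mul hU hα ((n : ℝ) - 2)⁻¹).congr fun x hx => ?_
  exact kulkarniNomizu_solve hn (I := (g x)⁻¹) (G := g x) (H := fun e b => pd e (pd b c) x)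
    (K := fun e a b d => integrabilityRemainder g h F c e a b d x
      - integrabilityRemainder g h F c a e b d x)
    (Matrix.nonsing_inv_mul _ ((Matrix.isUnit_iff_isUnit_det _).mp (hgm.isUnit hx)))
    (integrability_conformal hU hF3 (fun a b => hdiff (hg a b)) hc2 (fun p d => hdiff (hW p d))
      (fun a b d => hdiff (hZ a b d)) hK hx) e a

lemma conformal_regularity_step (hn : 3 ≤ n) (hα : α < 1) (hU : IsOpen U) (hV : IsOpen V) {j : ℕ}
    (hgm : IsMetricOn g U) (hhm : IsMetricOn h V)
    (hg : MetCHolderOn (j + 2) α U g) (hh : MetCHolderOn (j + 2) α V h)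
    (hFmaps : MapsTo F U V)
    (hF3 : ∀ i, ContDiffOn ℝ 3 (fun x => F x i) U) (hJ : ∀ x ∈ U, IsUnit (jac F x))
    (hconf : ∀ x ∈ U, (jac F x)ᵀ * h (F x) * jac F x = c x • g x)
    (hF : ∀ i, CHolderOn (j + 2) α U fun x => F x i)
    (hc2 : ContDiffOn ℝ 2 c U) (hc : ∀ a, CHolderOn j α U (pd a c)) :
    (∀ i, CHolderOn (j + 3) α U fun x => F x i) ∧ ∀ a, CHolderOn (j + 1) α U (pd a c) := by
  have hF1 : ∀ i, ContDiffOn ℝ 1 (fun x => F x i) U := fun i => (hF3 i).of_le (by norm_num)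
  have hJr : ∀ a i, CHolderOn (j + 1) α U (pd a fun x => F x i) := fun a i => (hF i).pd hU a
  have hF' : ∀ i, CHolderOn (j + 1) α U fun x => F x i := fun i => (hF i).of_le hU hα (by omega)
  have hg' : MetCHolderOn (j + 1) α U g := fun a b => (hg a b).of_le hU hα (by omega)
  have hh' : MetCHolderOn (j + 1) α V h := fun a b => (hh a b).of_le hV hα (by omega)
  have hhF : ∀ p q, CHolderOn (j + 1) α U fun x => h (F x) p q := fun p q =>
    (hh' p q).comp hU hV hα hF' hF1 hFmaps
  have hdhF : ∀ r p q, CHolderOn (j + 1) α U fun x => pd r (fun z => h z p q) (F x) :=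
    fun r p q => ((hh p q).pd hV r).comp hU hV hα hF' hF1 hFmaps
  have hdiff : ∀ {W : Set (Pt n)} {f : Pt n → ℝ}, IsOpen W → CHolderOn (j + 1) α W f →
      DifferentiableOn ℝ f W := fun hW hf => ((cHolderOn_succ_iff hW).mp hf).1
  have hcd : DifferentiableOn ℝ c U := hc2.differentiableOn (by norm_num)
  have hcr : CHolderOn (j + 1) α U c := (cHolderOn_succ_iff hU).mpr ⟨hcd, hc⟩
  have hW : ∀ p d, CHolderOn (j + 1) α U (loweredJac h F p d) := fun p d =>
    CHolderOn.sum hU hα _ fun q _ => (hhF p q).mul hU hα (hJr d q)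
  have hP : ∀ e a b, CHolderOn (j + 1) α U (pullbackDeriv h F e a b) := fun e a b =>
    CHolderOn.sum hU hα _ fun p _ => CHolderOn.sum hU hα _ fun q _ =>
      ((hJr a p).mul hU hα (CHolderOn.sum hU hα _ fun r _ =>
        (hdhF r p q).mul hU hα (hJr e r))).mul hU hα (hJr b q)
  have hZ : ∀ a b d, CHolderOn (j + 1) α U (koszulRemainder g h F c a b d) := fun a b d =>
    (hcr.mul hU hα ((((hg b d).pd hU a).add hU ((hg a d).pd hU b)).sub hU hα
      ((hg a b).pd hU d))).sub hU hα (((hP a b d).add hU (hP b a d)).sub hU hα (hP d a b))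
  have hK := fun x (hx : x ∈ U) a b d => conformal_koszul hU hV hFmaps
    (fun i => (hF3 i).of_le (by norm_num)) (fun a b => hdiff hU (hg' a b))
    (fun a b => hdiff hV (hh' a b)) hcd (fun y hy => (hhm y hy).1) hconf hx a b d
  have hψ := cHolderOn_pd_conformalFactor_succ hn hα hU hgm hg' hF3 hF hc2 hc hW hZ hK
  refine ⟨fun i => ?_, hψ⟩
  rw [cHolderOn_succ_iff hU]
  refine ⟨(hF1 i).differentiableOn (by norm_num), fun b => ?_⟩
  rw [cHolderOn_succ_iff hU]
  refine ⟨hdiff hU (hJr b i), fun a => ?_⟩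
  let A : Pt n → Matrix (Fin n) (Fin n) ℝ := fun x => Matrix.of fun p d => loweredJac h F p d x
  have hA : ∀ x ∈ U, IsUnit (A x) := fun x hx => by
    have : A x = h (F x) * jac F x := by
      ext p d
      rw [Matrix.mul_apply]
      rfl
    rw [this]
    exact (hhm.isUnit (hFmaps hx)).mul (hJ x hx)
  refine ((CHolderOn.sum hU hα Finset.univ fun d _ => ((((((hψ a).mul hU hα (hg' b d)).add hU
    ((hψ b).mul hU hα (hg' a d))).sub hU hα ((hψ d).mul hU hα (hg' a b))).add hU
    (hZ a b d)).mul hU hα (CHolderOn.matrix_inv (A := A) hU hα hW hA d i))).const_mul hU hα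
    (1 / 2)).congr fun x hx => ?_
  have h1 : A x * (A x)⁻¹ = 1 :=
    Matrix.mul_nonsing_inv _ ((Matrix.isUnit_iff_isUnit_det _).mp (hA x hx))
  have h2 : ∑ d, (∑ p, pd a (pd b fun y => F y p) x * loweredJac h F p d x) * (A x)⁻¹ d i
      = pd a (pd b fun y => F y i) x := by
    have h3 := congrFun (congrArg
      (fun M => (fun p => pd a (pd b fun y => F y p) x) ᵥ* M) h1) i
    rw [← Matrix.vecMul_vecMul, Matrix.vecMul_one] at h3
    exact h3
  beta_reduce
  rw [← h2, Finset.mul_sum]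
  refine Finset.sum_congr rfl fun d _ => ?_
  rw [← hK x hx a b d]
  ring

lemma contDiffOn_conformalFactor (hn : 0 < n) (hU : IsOpen U) (hgm : IsMetricOn g U)
    (hg : ∀ a b, ContDiffOn ℝ 2 (fun x => g x a b) U)
    (hh : ∀ a b, ContDiffOn ℝ 2 (fun x => h x a b) V) (hFmaps : MapsTo F U V)
    (hF3 : ∀ i, ContDiffOn ℝ 3 (fun x => F x i) U)
    (hconf : ∀ x ∈ U, (jac F x)ᵀ * h (F x) * jac F x = c x • g x) : ContDiffOn ℝ 2 c U := by
  let o : Fin n := ⟨0, hn⟩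
  have hpos : ∀ x ∈ U, g x o o ≠ 0 := fun x hx => ((hgm x hx).2.diag_pos).ne'
  have hJ : ∀ p, ContDiffOn ℝ 2 (pd o fun y => F y p) U := fun p =>
    ContDiffOn.pd (m := 2) hU (hF3 p) o
  have hFc : ContDiffOn ℝ 2 F U := contDiffOn_pi.mpr fun i => (hF3 i).of_le (by norm_num)
  have hN : ContDiffOn ℝ 2 (fun x => ∑ p, ∑ q, pd o (fun y => F y p) x * h (F x) p q *
      pd o (fun y => F y q) x) U :=
    ContDiffOn.sum fun p _ => ContDiffOn.sum fun q _ =>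
      ((hJ p).mul ((hh p q).comp hFc hFmaps)).mul (hJ q)
  refine (hN.div (hg o o) hpos).congr fun x hx => ?_
  exact (eq_div_iff (hpos x hx)).mpr (conformal_entry (hconf x hx) o o).symm

lemma conformal_regularity (hn : 3 ≤ n) {k : ℕ} (hα : α < 1) (hU : IsOpen U) (hV : IsOpen V)
    (hgm : IsMetricOn g U) (hhm : IsMetricOn h V)
    (hg : MetCHolderOn (k + 2) α U g) (hh : MetCHolderOn (k + 2) α V h)
    (hFmaps : MapsTo F U V)
    (hF3 : ∀ i, ContDiffOn ℝ 3 (fun x => F x i) U) (hJ : ∀ x ∈ U, IsUnit (jac F x))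
    (hconf : ∀ x ∈ U, (jac F x)ᵀ * h (F x) * jac F x = c x • g x) (i : Fin n) :
    CHolderOn (k + 3) α U fun x => F x i := by
  have h2 : (2 : WithTop ℕ∞) ≤ ((k + 2 : ℕ) : WithTop ℕ∞) := by
    exact_mod_cast Nat.le_add_left 2 k
  have hc2 : ContDiffOn ℝ 2 c U := contDiffOn_conformalFactor (by omega) hU hgm
    (fun a b => (hg a b).1.of_le h2) (fun a b => (hh a b).1.of_le h2) hFmaps hF3 hconf
  have key : ∀ j ≤ k + 1, (∀ i, CHolderOn (j + 2) α U fun x => F x i) ∧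
      ∀ a, CHolderOn j α U (pd a c) := by
    intro j
    induction j with
    | zero =>
      refine fun _ => ⟨fun i => CHolderOn.of_contDiffOn hU hα (hF3 i), fun a => ?_⟩
      exact CHolderOn.of_contDiffOn hU hα (ContDiffOn.pd (m := 1) hU hc2 a)
    | succ j ih =>
      intro hj
      obtain ⟨ih1, ih2⟩ := ih (by omega)
      exact conformal_regularity_step hn hα hU hV hgm hhm
        (fun a b => (hg a b).of_le hU hα (by omega)) (fun a b => (hh a b).of_le hV hα (by omega))
        hFmaps hF3 hJ hconf ih1 hc2 ih2
  exact (key (k + 1) le_rfl).1 i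

lemma jac_mul_jac_of_rightInverse (hU : IsOpen U) {W : Set (Pt n)} {G : Pt n → Pt n}
    (hW : IsOpen W) (hF : ∀ i, DifferentiableOn ℝ (fun x => F x i) U)
    (hG : ∀ i, DifferentiableOn ℝ (fun y => G y i) W) (hGm : MapsTo G W U)
    (hFG : ∀ y ∈ W, F (G y) = y) {y : Pt n} (hy : y ∈ W) : jac F (G y) * jac G y = 1 := by
  ext i b
  rw [Matrix.mul_apply]
  have h1 := pd_comp ((hF i).differentiableAt (hU.mem_nhds (hGm hy)))
    (fun j => (hG j).differentiableAt (hW.mem_nhds hy)) b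
  have h2 := pd_congr hW (f := fun y => F (G y) i) (f' := fun y => y i)
    (fun z hz => congrFun (hFG z hz) i) b hy
  rw [h1] at h2
  refine h2.trans ?_
  rw [Matrix.one_apply]
  exact pd_coord ..

lemma CHolderOn.rightInverse (hα : α < 1) (hU : IsOpen U) {k : ℕ}
    (hF : ∀ i, CHolderOn (k + 1) α U fun x => F x i) (hJ : ∀ x ∈ U, IsUnit (jac F x))
    {W : Set (Pt n)} {G : Pt n → Pt n} (hW : IsOpen W)
    (hG : ∀ i, ContDiffOn ℝ 1 (fun y => G y i) W) (hGm : MapsTo G W U)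
    (hFG : ∀ y ∈ W, F (G y) = y) (i : Fin n) : CHolderOn (k + 1) α W fun y => G y i := by
  have hGd : ∀ i, DifferentiableOn ℝ (fun y => G y i) W := fun i =>
    (hG i).differentiableOn (by norm_num)
  have hinv := CHolderOn.matrix_inv (A := jac F) hU hα (fun i a => (hF i).pd hU a) hJ
  have key : ∀ j ≤ k + 1, ∀ i, CHolderOn j α W fun y => G y i := by
    intro j
    induction j with
    | zero => exact fun _ i => CHolderOn.of_contDiffOn hW hα (by simpa using hG i)
    | succ j ih =>
      intro hj i
      refine (cHolderOn_succ_iff hW).mpr ⟨hGd i, fun b => ?_⟩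
      refine (((hinv i b).of_le hU hα (j := j) (by omega)).comp hW hU hα (ih (by omega)) hG
        hGm).congr fun y hy => ?_
      beta_reduce
      rw [Matrix.inv_eq_right_inv (jac_mul_jac_of_rightInverse hU hW
        (fun i => ((cHolderOn_succ_iff hU).mp (hF i)).1) hGd hGm hFG hy)]
      rfl
  exact key (k + 1) le_rfl i

end Bootstrap

/-- Theorem 3.2, Hölder case: regularity of conformal mappings and of their
`C¹` local inverses. -/
theorem conformal_map_regularity_holder
    (n k : ℕ) (hn : 3 ≤ n) (hk : 2 ≤ k) (α : ℝ) (hα : α ∈ Set.Ioo (0 : ℝ) 1)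
    (U V : Set (Pt n)) (hU : IsOpen U) (hV : IsOpen V)
    (g h : Met n) (hgm : IsMetricOn g U) (hhm : IsMetricOn h V)
    (hgr : MetCHolderOn k α U g) (hhr : MetCHolderOn k α V h)
    (F : Pt n → Pt n) (hFmaps : Set.MapsTo F U V)
    (hFreg : ∀ i, ContDiffOn ℝ 3 (fun x => F x i) U)
    (hFdiff : ∀ x ∈ U, IsUnit (jac F x))
    (c : Pt n → ℝ)
    (hconf : ∀ x ∈ U, (jac F x)ᵀ * h (F x) * jac F x = c x • g x) :
    (∀ i, CHolderOn (k + 1) α U fun x => F x i) ∧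
    (∀ (W : Set (Pt n)) (G : Pt n → Pt n), IsOpen W →
      (∀ i, ContDiffOn ℝ 1 (fun y => G y i) W) → Set.MapsTo G W U →
      (∀ y ∈ W, F (G y) = y) →
      ∀ i, CHolderOn (k + 1) α W fun y => G y i) := by
  obtain ⟨k, rfl⟩ := Nat.exists_eq_add_of_le' hk
  have hFk := conformal_regularity hn hα.2 hU hV hgm hhm hgr hhr hFmaps hFreg hFdiff hconf
  exact ⟨hFk, fun W G hW hG hGm hFG => CHolderOn.rightInverse hα.2 hU hFk hFdiff hW hG hGm hFG⟩
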